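/- arXiv:2006.02329 — 5 statements merged into one kernel-verified Lean document; each statement's English description precedes it below -/
import Mathlib

section
/- Let Z be a measurable space, f a conformal e-predictor on Z, and (Z_1,…,Z_m) an exchangeable sequence of Z-valued random elements, i.e. the joint distribution of (Z_1,…,Z_m) is invariant under every permutation of the indices. Then the expectation of the conformal e-value f(⟦Z_1,…,Z_{m-1}⟧, Z_m) equals 1. -/
open MeasureTheory ProbabilityTheory

/-- A conformal e-predictor on a measurable space `Z`: a measurable equivariant function
mapping each finite sequence `(z_1, …, z_m)` to a sequence `(α_1, …, α_m)` of nonnegative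
reals with average `1`. -/
structure ConformalEPredictor (Z : Type*) [MeasurableSpace Z] where
  f : (m : ℕ) → (Fin m → Z) → (Fin m → ℝ)
  measurable : ∀ m, Measurable (f m)
  nonneg : ∀ m (z : Fin m → Z) (i : Fin m), 0 ≤ f m z i
  avg : ∀ m (z : Fin m → Z), ∑ i, f m z i = m
  equivariant : ∀ m (π : Equiv.Perm (Fin m)) (z : Fin m → Z) (i : Fin m),
    f m (fun j => z (π j)) i = f m z (π i)

namespace ConformalEPredictor

variable {Z : Type*} [MeasurableSpace Z] (P : ConformalEPredictor Z)

theorem measurable_apply (m : ℕ) (i : Fin m) : Measurable fun z => P.f m z i :=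
  (measurable_pi_apply i).comp (P.measurable m)

theorem le_length (m : ℕ) (z : Fin m → Z) (i : Fin m) : P.f m z i ≤ m :=
  (Finset.single_le_sum (fun j _ => P.nonneg m z j) (Finset.mem_univ i)).trans_eq (P.avg m z)

theorem integrable_apply (m : ℕ) (i : Fin m) (ν : Measure (Fin m → Z)) [IsFiniteMeasure ν] :
    Integrable (fun z => P.f m z i) ν :=
  Integrable.of_bound (P.measurable_apply m i).aestronglyMeasurable m
    (ae_of_all _ fun z => by
      rw [Real.norm_of_nonneg (P.nonneg m z i)]
      exact P.le_length m z i)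

/-- Under a permutation-invariant law all components have the same expectation. -/
theorem integral_apply_eq {m : ℕ} {ν : Measure (Fin m → Z)}
    (hν : ∀ π : Equiv.Perm (Fin m), ν.map (fun z i => z (π i)) = ν) (i j : Fin m) :
    ∫ z, P.f m z i ∂ν = ∫ z, P.f m z j ∂ν := by
  have hπ : Measurable fun (z : Fin m → Z) k => z (Equiv.swap i j k) := by fun_prop
  conv_lhs => rw [← hν (Equiv.swap i j)]
  rw [integral_map hπ.aemeasurable (P.measurable_apply m i).aestronglyMeasurable]
  simp only [P.equivariant, Equiv.swap_apply_left]

theorem integral_apply_eq_one {m : ℕ} {ν : Measure (Fin m → Z)} [IsProbabilityMeasure ν]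
    (hν : ∀ π : Equiv.Perm (Fin m), ν.map (fun z i => z (π i)) = ν) (i : Fin m) :
    ∫ z, P.f m z i ∂ν = 1 := by
  have hsum : ∑ j, ∫ z, P.f m z j ∂ν = m := by
    rw [← integral_finsetSum _ fun j _ => P.integrable_apply m j ν]
    simp [P.avg]
  simp only [fun j => P.integral_apply_eq hν j i, Finset.sum_const, Finset.card_univ,
    Fintype.card_fin, nsmul_eq_mul] at hsum
  have hm : (m : ℝ) ≠ 0 := Nat.cast_ne_zero.mpr i.pos.ne'
  exact mul_left_cancel₀ hm (hsum.trans (mul_one _).symm)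

end ConformalEPredictor

/-- **Conformal e-values have expectation 1 under exchangeability.** If `(Z_1, …, Z_m)`
(here `m = N + 1 ≥ 1`) is exchangeable, i.e. its joint distribution is invariant under every
permutation of the indices, then the conformal e-value `f(⟦Z_1, …, Z_{m-1}⟧, Z_m)`, i.e. the
last component of `f(Z_1, …, Z_m)`, has expectation `1`. -/
theorem conformal_eValue_expectation_one {Ω Z : Type*} [MeasurableSpace Ω] [MeasurableSpace Z]
    (μ : Measure Ω) [IsProbabilityMeasure μ]
    (P : ConformalEPredictor Z) (N : ℕ) (Zs : Fin (N + 1) → Ω → Z)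
    (hmeas : ∀ i, Measurable (Zs i))
    (hexch : ∀ π : Equiv.Perm (Fin (N + 1)),
      Measure.map (fun ω => fun i => Zs (π i) ω) μ = Measure.map (fun ω => fun i => Zs i ω) μ) :
    ∫ ω, P.f (N + 1) (fun i => Zs i ω) (Fin.last N) ∂μ = 1 := by
  have hZ : Measurable fun ω i => Zs i ω := measurable_pi_lambda _ hmeas
  have := Measure.isProbabilityMeasure_map (μ := μ) hZ.aemeasurable
  rw [← integral_map hZ.aemeasurable
    (P.measurable_apply (N + 1) (Fin.last N)).aestronglyMeasurable]
  refine P.integral_apply_eq_one (fun π => ?_) (Fin.last N)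
  rw [Measure.map_map (by fun_prop) hZ]
  exact hexch π
end

section
/- Let N ≥ 1, let E_1,…,E_N be nonnegative real numbers, and let c > 1. Let σ_0 := 0 and σ_k := min{ n > σ_{k-1} : ∑_{i=σ_{k-1}+1}^{n} E_{σ_{k-1}+1}⋯E_i ≥ c } be the Roberts–Shiryaev stopping times, and let τ_0 := N+1 and τ_k := max{ n < τ_{k-1} : ∑_{i=n}^{τ_{k-1}-1} E_n·E_{n+1}⋯E_i ≥ c } (with max ∅ := 0) be the reversed Shiryaev–Roberts stopping times. Then for every k ≥ 0 with σ_{k+1} ≤ N, the set {σ_k+1, σ_k+2, …, σ_{k+1}} contains at least one τ_j with τ_j > 0. -/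
/-- Given values `E_1, E_2, …` (represented by `E 0, E 1, …`), the first time
`n > s` such that `∑_{i=s+1}^{n} E_{s+1} ⋯ E_i ≥ c`, as an element of `ℕ∞` (so `⊤ = min ∅`). -/
noncomputable def nextRS (E : ℕ → ℝ) (c : ℝ) (s : ℕ) : ℕ∞ :=
  sInf {n : ℕ∞ | ∃ m : ℕ, n = m ∧ s < m ∧
    c ≤ ∑ i ∈ Finset.Ico s m, ∏ j ∈ Finset.Icc s i, E j}

/-- The Roberts–Shiryaev stopping times `σ_0 := 0`,
`σ_k := min{ n > σ_{k-1} : ∑_{i=σ_{k-1}+1}^{n} E_{σ_{k-1}+1} ⋯ E_i ≥ c }` (`min ∅ := ∞`),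
for the values `E_1, E_2, …` represented by `E 0, E 1, …`. -/
noncomputable def sigmaRS (E : ℕ → ℝ) (c : ℝ) : ℕ → ℕ∞
  | 0 => 0
  | k + 1 => WithTop.recTopCoe ⊤ (nextRS E c) (sigmaRS E c k)

/-- The reversed Shiryaev–Roberts stopping times `τ_0 := N + 1`,
`τ_k := max{ n < τ_{k-1} : ∑_{i=n}^{τ_{k-1}-1} E_n ⋯ E_i ≥ c }` (`max ∅ := 0`, times `n ≥ 1`),
for the values `E_1, …, E_N` represented by `E 0, …, E (N-1)`. -/
noncomputable def tauSR (E : ℕ → ℝ) (c : ℝ) (N : ℕ) : ℕ → ℕ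
  | 0 => N + 1
  | k + 1 => sSup {n : ℕ | 1 ≤ n ∧ n < tauSR E c N k ∧
      c ≤ ∑ i ∈ Finset.Ico (n - 1) (tauSR E c N k - 1), ∏ j ∈ Finset.Icc (n - 1) i, E j}

theorem exists_nextRS_eq_coe {E : ℕ → ℝ} {c : ℝ} {s : ℕ} (h : nextRS E c s ≠ ⊤) :
    ∃ m : ℕ, nextRS E c s = m ∧ s < m ∧
      c ≤ ∑ i ∈ Finset.Ico s m, ∏ j ∈ Finset.Icc s i, E j := by
  refine csInf_mem (s := {n : ℕ∞ | ∃ m : ℕ, n = m ∧ s < m ∧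
    c ≤ ∑ i ∈ Finset.Ico s m, ∏ j ∈ Finset.Icc s i, E j}) ?_
  rw [Set.nonempty_iff_ne_empty]
  intro he
  exact h (by rw [nextRS, he, sInf_empty])

/-- If the sum started just after `s` reaches `c` by time `m`, then a reversed alarm after `m` is
followed by one that is positive, strictly earlier, and still after `s`. -/
theorem lt_tauSR_succ_lt {E : ℕ → ℝ} (hE : ∀ i, 0 ≤ E i) {c : ℝ} {N s m j : ℕ} (hsm : s < m)
    (hc : c ≤ ∑ i ∈ Finset.Ico s m, ∏ l ∈ Finset.Icc s i, E l) (hm : m < tauSR E c N j) :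
    s < tauSR E c N (j + 1) ∧ tauSR E c N (j + 1) < tauSR E c N j := by
  set S := {n : ℕ | 1 ≤ n ∧ n < tauSR E c N j ∧
    c ≤ ∑ i ∈ Finset.Ico (n - 1) (tauSR E c N j - 1), ∏ l ∈ Finset.Icc (n - 1) i, E l} with hS
  have hτ : tauSR E c N (j + 1) = sSup S := rfl
  have hbdd : BddAbove S := ⟨tauSR E c N j, fun n hn => hn.2.1.le⟩
  have hmem : s + 1 ∈ S := by
    refine ⟨by omega, by omega, hc.trans ?_⟩
    rw [Nat.add_sub_cancel]
    exact Finset.sum_le_sum_of_subset_of_nonneg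
      (Finset.Ico_subset_Ico_right (by omega))
      fun i _ _ => Finset.prod_nonneg fun l _ => hE l
  rw [hτ]
  exact ⟨le_csSup hbdd hmem, (Nat.sSup_mem ⟨_, hmem⟩ hbdd).2.1⟩

/-- **Each Roberts–Shiryaev inter-alarm interval contains a reversed Shiryaev–Roberts alarm.**
For nonnegative `E_1, …, E_N` and `c > 1`, for every `k` with `σ_{k+1} ≤ N`, the set
`{σ_k + 1, …, σ_{k+1}}` contains at least one `τ_j` with `τ_j > 0`. -/
theorem tau_in_sigma_interval (N : ℕ) (hN : 1 ≤ N) (E : ℕ → ℝ) (hE : ∀ i, 0 ≤ E i)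
    (c : ℝ) (hc : 1 < c) (k : ℕ) (hk : sigmaRS E c (k + 1) ≤ (N : ℕ∞)) :
    ∃ j, 0 < tauSR E c N j ∧ sigmaRS E c k < (tauSR E c N j : ℕ∞) ∧
      (tauSR E c N j : ℕ∞) ≤ sigmaRS E c (k + 1) := by
  obtain hs | ⟨s, hs⟩ : sigmaRS E c k = ⊤ ∨ ∃ s : ℕ, (s : ℕ∞) = sigmaRS E c k := by
    rw [← ENat.ne_top_iff_exists]
    exact eq_or_ne _ _
  · rw [sigmaRS, hs] at hk
    exact absurd (top_le_iff.mp hk) (ENat.natCast_ne_top N)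
  have hnext : sigmaRS E c (k + 1) = nextRS E c s := by
    rw [sigmaRS, ← hs]
    rfl
  obtain ⟨m, hm, hsm, hsum⟩ := exists_nextRS_eq_coe (E := E) (c := c) (s := s)
    (hnext ▸ ne_top_of_le_ne_top (ENat.natCast_ne_top N) hk)
  rw [hnext, hm] at hk ⊢
  rw [← hs]
  simp only [Nat.cast_lt, Nat.cast_le] at hk ⊢
  have hex : ∃ j, tauSR E c N j ≤ m := by
    by_contra! h
    exact not_strictAnti_of_wellFoundedLT (tauSR E c N)
      (strictAnti_nat_of_succ_lt fun j => (lt_tauSR_succ_lt hE hsm hsum (h j)).2)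
  classical
  obtain ⟨j, hj, hmin⟩ : ∃ j, tauSR E c N j ≤ m ∧ ∀ i < j, m < tauSR E c N i :=
    ⟨Nat.find hex, Nat.find_spec hex, fun i hi => not_le.mp (Nat.find_min hex hi)⟩
  cases j with
  | zero =>
    rw [tauSR] at hj
    omega
  | succ j =>
    have h := (lt_tauSR_succ_lt hE hsm hsum (hmin j j.lt_succ_self)).1
    exact ⟨j + 1, by omega, h, hj⟩
end

section
/- Let N ≥ 1, let E_1,…,E_N be nonnegative real numbers, and let c > 1. Let σ_0 := 0 and σ_k := min{ n > σ_{k-1} : ∑_{i=σ_{k-1}+1}^{n} E_{σ_{k-1}+1}⋯E_i ≥ c } be the Roberts–Shiryaev stopping times, with alarm count A_N := max{ k : σ_k ≤ N }; let τ_0 := N+1 and τ_k := max{ n < τ_{k-1} : ∑_{i=n}^{τ_{k-1}-1} E_n·E_{n+1}⋯E_i ≥ c } (max ∅ := 0) be the reversed Shiryaev–Roberts stopping times, with alarm count A'_N := max{ k : τ_k > 0 }. Then A_N ≤ A'_N. -/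
/-- The Roberts–Shiryaev statistic started at time `s` has reached the level `c` whenever the
next stopping time is finite. -/
theorem exists_of_sigmaRS_succ_eq {E : ℕ → ℝ} {c : ℝ} {k m : ℕ}
    (h : sigmaRS E c (k + 1) = m) :
    ∃ s : ℕ, sigmaRS E c k = s ∧ s < m ∧
      c ≤ ∑ i ∈ Finset.Ico s m, ∏ j ∈ Finset.Icc s i, E j := by
  rw [sigmaRS] at h
  cases hs : sigmaRS E c k with
  | top =>
    rw [hs] at h
    exact absurd h (ENat.natCast_ne_top m).symm
  | coe s =>
    rw [hs] at h
    change nextRS E c s = m at h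
    have hne : {n : ℕ∞ | ∃ m : ℕ, n = m ∧ s < m ∧
        c ≤ ∑ i ∈ Finset.Ico s m, ∏ j ∈ Finset.Icc s i, E j}.Nonempty := by
      by_contra hempty
      rw [Set.not_nonempty_iff_eq_empty] at hempty
      rw [nextRS, hempty, sInf_empty] at h
      exact absurd h (ENat.natCast_ne_top m).symm
    obtain ⟨m', hm', hlt, hle⟩ := csInf_mem hne
    have hmm : m = m' := by
      exact_mod_cast h.symm.trans hm'
    subst hmm
    exact ⟨s, rfl, hlt, hle⟩

/-- A time before `tauSR E c N j` at which the reversed statistic reaches `c` is at most the next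
reversed stopping time. -/
theorem le_tauSR_succ {E : ℕ → ℝ} {c : ℝ} {N j n : ℕ} (hn : 1 ≤ n) (hlt : n < tauSR E c N j)
    (hc : c ≤ ∑ i ∈ Finset.Ico (n - 1) (tauSR E c N j - 1), ∏ l ∈ Finset.Icc (n - 1) i, E l) :
    n ≤ tauSR E c N (j + 1) := by
  rw [tauSR]
  exact le_csSup ⟨tauSR E c N j, fun _ h => h.2.1.le⟩ ⟨hn, hlt, hc⟩

/-- The `j`-th reversed stopping time is later than the `j`-th last Roberts–Shiryaev one. -/
theorem exists_sigmaRS_lt_tauSR {E : ℕ → ℝ} (hE : ∀ i, 0 ≤ E i) {c : ℝ} {N : ℕ} (j : ℕ) :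
    ∀ k : ℕ, sigmaRS E c (k + j) ≤ (N : ℕ∞) →
      ∃ s : ℕ, sigmaRS E c k = s ∧ s < tauSR E c N j := by
  induction j with
  | zero =>
    intro k hk
    obtain ⟨s, hs, hsN⟩ := ENat.le_natCast_iff.mp hk
    exact ⟨s, hs, Nat.lt_succ_of_le hsN⟩
  | succ j ih =>
    intro k hk
    obtain ⟨m, hm, hmτ⟩ := ih (k + 1) (by rwa [add_right_comm, add_assoc])
    obtain ⟨s, hs, hsm, hc⟩ := exists_of_sigmaRS_succ_eq hm
    refine ⟨s, hs, le_tauSR_succ (Nat.succ_pos s) (lt_of_le_of_lt hsm hmτ) ?_⟩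
    rw [Nat.succ_sub_one]
    refine hc.trans (Finset.sum_le_sum_of_subset_of_nonneg
      (Finset.Ico_subset_Ico_right (Nat.le_sub_one_of_lt hmτ)) fun i _ _ => ?_)
    exact Finset.prod_nonneg fun l _ => hE l

/-- The reversed stopping times decrease strictly until they reach `0`. -/
theorem tauSR_add_le {E : ℕ → ℝ} {c : ℝ} {N : ℕ} (k : ℕ) (hk : 0 < tauSR E c N k) :
    tauSR E c N k + k ≤ N + 1 := by
  induction k with
  | zero => simp [tauSR]
  | succ k ih =>
    rw [tauSR] at hk
    have hne : {n : ℕ | 1 ≤ n ∧ n < tauSR E c N k ∧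
        c ≤ ∑ i ∈ Finset.Ico (n - 1) (tauSR E c N k - 1),
          ∏ j ∈ Finset.Icc (n - 1) i, E j}.Nonempty := by
      by_contra hempty
      rw [Set.not_nonempty_iff_eq_empty] at hempty
      rw [hempty, csSup_empty] at hk
      exact lt_irrefl _ hk
    have hmem := Nat.sSup_mem hne ⟨tauSR E c N k, fun _ h => h.2.1.le⟩
    have hlt : tauSR E c N (k + 1) < tauSR E c N k := by
      rw [tauSR]
      exact hmem.2.1
    have := ih (by omega)
    omega

/-- **Roberts–Shiryaev raises no more alarms than the reversed Shiryaev–Roberts procedure.**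
For nonnegative `E_1, …, E_N` and `c > 1`, the alarm counts `A_N := max{ k : σ_k ≤ N }`
(Roberts–Shiryaev) and `A'_N := max{ k : τ_k > 0 }` (reversed Shiryaev–Roberts) satisfy
`A_N ≤ A'_N`. -/
theorem alarms_RS_le_alarms_reversedSR (N : ℕ) (hN : 1 ≤ N) (E : ℕ → ℝ) (hE : ∀ i, 0 ≤ E i)
    (c : ℝ) (hc : 1 < c) :
    sSup {k : ℕ | sigmaRS E c k ≤ (N : ℕ∞)} ≤ sSup {k : ℕ | 0 < tauSR E c N k} := by
  refine csSup_le' fun k hk => ?_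
  obtain ⟨s, -, hs⟩ := exists_sigmaRS_lt_tauSR hE k 0 (by rwa [zero_add])
  refine le_csSup ⟨N + 1, fun l hl => ?_⟩ (Nat.zero_lt_of_lt hs)
  exact (Nat.le_add_left l _).trans (tauSR_add_le l hl)
end

section
/- Let E_1, E_2, … be nonnegative real numbers and c > 1. Let σ_0 := 0 and σ_k := min{ n > σ_{k-1} : ∑_{i=σ_{k-1}+1}^{n} E_{σ_{k-1}+1}⋯E_i ≥ c } be the Roberts–Shiryaev stopping times, and let σ'_0 := 0 and σ'_k := min{ n > σ'_{k-1} : E_{σ'_{k-1}+1}·E_{σ'_{k-1}+2}⋯E_n ≥ c } be the MUSUC stopping times (both with min ∅ := ∞). Then σ_k ≤ σ'_k for every k ≥ 0. -/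
/-- Given values `E_1, E_2, …` (represented by `E 0, E 1, …`), the first time
`n > s` such that `E_{s+1} ⋯ E_n ≥ c`, as an element of `ℕ∞` (so `⊤ = min ∅`). -/
noncomputable def nextMU (E : ℕ → ℝ) (c : ℝ) (s : ℕ) : ℕ∞ :=
  sInf {n : ℕ∞ | ∃ m : ℕ, n = m ∧ s < m ∧ c ≤ ∏ j ∈ Finset.Ico s m, E j}

/-- The MUSUC stopping times `σ'_0 := 0`,
`σ'_k := min{ n > σ'_{k-1} : E_{σ'_{k-1}+1} ⋯ E_n ≥ c }` (`min ∅ := ∞`),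
for the values `E_1, E_2, …` represented by `E 0, E 1, …`. -/
noncomputable def sigmaMU (E : ℕ → ℝ) (c : ℝ) : ℕ → ℕ∞
  | 0 => 0
  | k + 1 => WithTop.recTopCoe ⊤ (nextMU E c) (sigmaMU E c k)

/-- A finite value of `nextMU` is attained, and the product stays below `c` before it. -/
lemma nextMU_eq_coe {E : ℕ → ℝ} {c : ℝ} {s m : ℕ} (h : nextMU E c s = m) :
    s < m ∧ c ≤ ∏ j ∈ Finset.Ico s m, E j ∧
      ∀ n, s < n → n < m → ∏ j ∈ Finset.Ico s n, E j < c := by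
  have hne : {n : ℕ∞ | ∃ m : ℕ, n = m ∧ s < m ∧ c ≤ ∏ j ∈ Finset.Ico s m, E j}.Nonempty := by
    by_contra hempty
    rw [Set.not_nonempty_iff_eq_empty] at hempty
    rw [nextMU, hempty, sInf_empty] at h
    exact ENat.natCast_ne_top m h.symm
  have hmem := csInf_mem hne
  change nextMU E c s ∈ _ at hmem
  rw [h] at hmem
  obtain ⟨m', hm', hlt, hc⟩ := hmem
  obtain rfl : m = m' := by exact_mod_cast hm'
  refine ⟨hlt, hc, fun n hsn hnm => ?_⟩
  by_contra! hcn
  have hle : nextMU E c s ≤ n := sInf_le ⟨n, rfl, hsn, hcn⟩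
  rw [h] at hle
  exact absurd (by exact_mod_cast hle) hnm.not_ge

lemma exists_sigmaMU_eq_coe_of_succ {E : ℕ → ℝ} {c : ℝ} {k m : ℕ}
    (h : sigmaMU E c (k + 1) = m) :
    ∃ p : ℕ, sigmaMU E c k = p ∧ nextMU E c p = m := by
  rw [sigmaMU] at h
  cases hp : sigmaMU E c k with
  | top =>
    rw [hp] at h
    exact absurd h.symm (ENat.natCast_ne_top m)
  | coe p =>
    rw [hp] at h
    exact ⟨p, rfl, h⟩

/-- Every product of consecutive values ending at a finite MUSUC time is at least `1`. -/
lemma one_le_prod_Ico_sigmaMU {E : ℕ → ℝ} (hE : ∀ i, 0 ≤ E i) {c : ℝ} (hc : 1 < c)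
    {k m s : ℕ} (hm : sigmaMU E c k = m) (hs : s ≤ m) :
    1 ≤ ∏ j ∈ Finset.Ico s m, E j := by
  induction k generalizing m with
  | zero =>
    rw [sigmaMU] at hm
    obtain rfl : 0 = m := by exact_mod_cast hm
    simp
  | succ k ih =>
    obtain ⟨p, hp, hpm⟩ := exists_sigmaMU_eq_coe_of_succ hm
    obtain ⟨hlt, hcm, hmin⟩ := nextMU_eq_coe hpm
    rcases le_or_gt s p with hsp | hps
    · rw [← Finset.prod_Ico_consecutive E hsp hlt.le]
      nlinarith [ih hp hsp]
    · rcases hs.eq_or_lt with rfl | hsm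
      · simp
      · rw [← Finset.prod_Ico_consecutive E hps.le hsm.le] at hcm
        have h0 : 0 ≤ ∏ j ∈ Finset.Ico p s, E j := Finset.prod_nonneg fun i _ => hE i
        nlinarith [hmin s hps hsm]

/-- The Roberts–Shiryaev sum dominates its last summand. -/
lemma nextRS_le_of_le_prod {E : ℕ → ℝ} (hE : ∀ i, 0 ≤ E i) {c : ℝ} {s m : ℕ} (hsm : s < m)
    (hc : c ≤ ∏ j ∈ Finset.Ico s m, E j) : nextRS E c s ≤ m := by
  refine sInf_le ⟨m, rfl, hsm, hc.trans ?_⟩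
  obtain ⟨n, rfl⟩ : ∃ n, m = n + 1 := ⟨m - 1, by omega⟩
  have hIco : Finset.Ico s (n + 1) = Finset.Icc s n := by
    ext
    simp
  calc ∏ j ∈ Finset.Ico s (n + 1), E j = ∏ j ∈ Finset.Icc s n, E j := by rw [hIco]
    _ ≤ ∑ i ∈ Finset.Ico s (n + 1), ∏ j ∈ Finset.Icc s i, E j :=
      Finset.single_le_sum (f := fun i => ∏ j ∈ Finset.Icc s i, E j)
        (fun i _ => Finset.prod_nonneg fun j _ => hE j) (Finset.mem_Ico.mpr ⟨by omega, by omega⟩)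

/-- **Roberts–Shiryaev alarms come no later than MUSUC alarms.** For nonnegative
`E_1, E_2, …` and `c > 1`, the Roberts–Shiryaev stopping times `σ_k` and the MUSUC stopping
times `σ'_k` (same parameter `c`, `min ∅ := ∞`, with `∞` the top of `ℕ∞`) satisfy
`σ_k ≤ σ'_k` for every `k`. -/
theorem sigmaRS_le_sigmaMU (E : ℕ → ℝ) (hE : ∀ i, 0 ≤ E i) (c : ℝ) (hc : 1 < c) (k : ℕ) :
    sigmaRS E c k ≤ sigmaMU E c k := by
  induction k with
  | zero => simp [sigmaRS, sigmaMU]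
  | succ k ih =>
    cases hm : sigmaMU E c (k + 1) with
    | top => exact le_top
    | coe m =>
      obtain ⟨p, hp, hpm⟩ := exists_sigmaMU_eq_coe_of_succ hm
      obtain ⟨hlt, hcm, -⟩ := nextMU_eq_coe hpm
      rw [hp] at ih
      obtain ⟨s, hs⟩ := ENat.ne_top_iff_exists.mp (ne_top_of_le_ne_top (ENat.natCast_ne_top p) ih)
      rw [← hs] at ih
      have hsp : s ≤ p := by exact_mod_cast ih
      have hstep : sigmaRS E c (k + 1) = nextRS E c s := by
        simp only [sigmaRS, ← hs]
        rfl
      rw [hstep]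
      refine nextRS_le_of_le_prod hE (hsp.trans_lt hlt) ?_
      rw [← Finset.prod_Ico_consecutive E hsp hlt.le]
      have h1 := one_le_prod_Ico_sigmaMU hE hc hp hsp
      nlinarith
end

section
/- For every c > 1 and every ε > 0 there exists N_0, depending only on ε and c, with the following property: for every N ≥ N_0, every probability space, every filtration G_0 ⊆ G_1 ⊆ … ⊆ G_N, and every strictly positive martingale (T_n, G_n), n = 0,1,…,N, with T_0 = 1, the Shiryaev–Roberts procedure with parameter c applied to (T_n) — i.e., the stopping times τ_0 := 0 and τ_k := min{ n > τ_{k-1} : ∑_{i=τ_{k-1}}^{n-1} T_n/T_i ≥ c } (min ∅ := ∞), with alarm count A_N := max{ k : τ_k ≤ N } — satisfies P(A_N/N > 1/c + ε) ≤ ε. -/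
open MeasureTheory ProbabilityTheory

/-- Given martingale values `T_0, T_1, …` (as `t 0, t 1, …`), the first time `n > s` such
that `∑_{i=s}^{n-1} T_n / T_i ≥ c`, as an element of `ℕ∞` (so `⊤ = min ∅`). -/
noncomputable def nextSR (t : ℕ → ℝ) (c : ℝ) (s : ℕ) : ℕ∞ :=
  sInf {n : ℕ∞ | ∃ m : ℕ, n = m ∧ s < m ∧ c ≤ ∑ i ∈ Finset.Ico s m, t m / t i}

/-- The Shiryaev–Roberts stopping times `τ_0 := 0`,
`τ_k := min{ n > τ_{k-1} : ∑_{i=τ_{k-1}}^{n-1} T_n / T_i ≥ c }` (`min ∅ := ∞`), applied to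
the sequence of values `t n = T_n`. -/
noncomputable def tauSRmart (t : ℕ → ℝ) (c : ℝ) : ℕ → ℕ∞
  | 0 => 0
  | k + 1 => WithTop.recTopCoe ⊤ (nextSR t c) (tauSRmart t c k)

/-- The Shiryaev–Roberts statistic at time `n + 1`, before a possible reset, when its value at
time `n` is `r`. -/
noncomputable def srStep (t : ℕ → ℝ) (n : ℕ) (r : ℝ) : ℝ := t (n + 1) / t n * (r + 1)

/-- The Shiryaev–Roberts statistic, reset to `0` at every alarm. -/
noncomputable def srStat (t : ℕ → ℝ) (c : ℝ) : ℕ → ℝ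
  | 0 => 0
  | n + 1 => if c ≤ srStep t n (srStat t c n) then 0 else srStep t n (srStat t c n)

/-- The number of alarms raised up to a given time, computed recursively. -/
noncomputable def srCount (t : ℕ → ℝ) (c : ℝ) : ℕ → ℕ
  | 0 => 0
  | n + 1 => if c ≤ srStep t n (srStat t c n) then srCount t c n + 1 else srCount t c n

lemma lt_nextSR_iff (t : ℕ → ℝ) (c : ℝ) (s n : ℕ) :
    (n : ℕ∞) < nextSR t c s ↔
      ∀ m, s < m → m ≤ n → ∑ i ∈ Finset.Ico s m, t m / t i < c := by
  constructor
  · intro h m hsm hmn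
    by_contra! hc
    have : nextSR t c s ≤ m := sInf_le ⟨m, rfl, hsm, hc⟩
    exact absurd (h.trans_le this) (by simpa using hmn)
  · intro h
    have : ((n + 1 : ℕ) : ℕ∞) ≤ nextSR t c s := by
      refine le_sInf ?_
      rintro _ ⟨m, rfl, hsm, hc⟩
      by_contra! hm
      have hm' : m ≤ n := by
        have : m < n + 1 := by exact_mod_cast hm
        omega
      exact absurd (h m hsm hm') (not_lt.2 hc)
    refine lt_of_lt_of_le ?_ this
    exact_mod_cast Nat.lt_succ_self n

lemma tauSRmart_succ_of_eq {t : ℕ → ℝ} {c : ℝ} {k s : ℕ} (h : tauSRmart t c k = s) :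
    tauSRmart t c (k + 1) = nextSR t c s := by
  rw [tauSRmart, h]; rfl

lemma tauSRmart_mono (t : ℕ → ℝ) (c : ℝ) : Monotone (tauSRmart t c) := by
  refine monotone_nat_of_le_succ fun k => ?_
  cases h : tauSRmart t c k using WithTop.recTopCoe with
  | top => rw [tauSRmart, h]; rfl
  | coe s =>
    have h' : tauSRmart t c (k + 1) = nextSR t c s := tauSRmart_succ_of_eq h
    rw [h']
    exact ((lt_nextSR_iff t c s s).2 fun m h₁ h₂ => absurd h₁ (not_lt.2 h₂)).le

lemma srStep_sum {t : ℕ → ℝ} {s n : ℕ} (hsn : s ≤ n) (hn : t n ≠ 0) :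
    srStep t n (∑ i ∈ Finset.Ico s n, t n / t i) =
      ∑ i ∈ Finset.Ico s (n + 1), t (n + 1) / t i := by
  rw [Finset.sum_Ico_succ_top hsn, srStep, mul_add, Finset.mul_sum, mul_one]
  congr 1
  refine Finset.sum_congr rfl fun i _ => ?_
  field_simp

/-- The recursive description of the Shiryaev–Roberts procedure: up to time `n` exactly
`srCount t c n` alarms are raised, and `srStat` is the running sum since the last of them. -/
lemma exists_tauSRmart_srCount {t : ℕ → ℝ} {c : ℝ} {N : ℕ} (ht : ∀ n ≤ N, t n ≠ 0) :
    ∀ n ≤ N, ∃ s ≤ n, tauSRmart t c (srCount t c n) = s ∧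
      srStat t c n = ∑ i ∈ Finset.Ico s n, t n / t i ∧ (n : ℕ∞) < nextSR t c s := by
  intro n
  induction n with
  | zero =>
    intro _
    refine ⟨0, le_rfl, rfl, by simp [srStat], (lt_nextSR_iff t c 0 0).2 fun m h₁ h₂ => ?_⟩
    omega
  | succ n ih =>
    intro hn
    obtain ⟨s, hsn, hτ, hr, hlt⟩ := ih (by omega)
    have hp := srStep_sum hsn (ht n (by omega))
    rw [← hr] at hp
    by_cases h : c ≤ srStep t n (srStat t c n)
    · refine ⟨n + 1, le_rfl, ?_, by simp [srStat, h], ?_⟩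
      · rw [srCount, if_pos h, tauSRmart_succ_of_eq hτ]
        refine le_antisymm (sInf_le ⟨n + 1, rfl, by omega, hp ▸ h⟩) ?_
        rw [Nat.cast_add, Nat.cast_one]
        exact Order.add_one_le_of_lt hlt
      · exact (lt_nextSR_iff t c _ _).2 fun m h₁ h₂ => absurd h₁ (not_lt.2 h₂)
    · refine ⟨s, by omega, by rw [srCount, if_neg h, hτ], by rw [srStat, if_neg h, hp], ?_⟩
      rw [lt_nextSR_iff] at hlt ⊢
      intro m h₁ h₂
      rcases h₂.lt_or_eq with h₂ | rfl
      · exact hlt m h₁ (by omega)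
      · rw [← hp]; exact not_le.1 h

lemma sSup_tauSRmart_le_srCount {t : ℕ → ℝ} {c : ℝ} {N : ℕ} (ht : ∀ n ≤ N, t n ≠ 0) :
    sSup {k : ℕ | tauSRmart t c k ≤ (N : ℕ∞)} ≤ srCount t c N := by
  obtain ⟨s, -, hτ, -, hlt⟩ := exists_tauSRmart_srCount (c := c) ht N le_rfl
  refine csSup_le ⟨0, by simp [tauSRmart]⟩ fun k hk => ?_
  by_contra! h
  have := tauSRmart_mono t c (Nat.succ_le_of_lt h)
  rw [Nat.succ_eq_add_one, tauSRmart_succ_of_eq hτ] at this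
  exact absurd (hlt.trans_le (this.trans hk)) (lt_irrefl _)

lemma srStat_nonneg {t : ℕ → ℝ} {c : ℝ} {N : ℕ} (ht : ∀ n ≤ N, 0 < t n) :
    ∀ n ≤ N, 0 ≤ srStat t c n := by
  intro n
  induction n with
  | zero => intro _; simp [srStat]
  | succ n ih =>
    intro hn
    have h₀ := ih (by omega)
    have h₁ := ht n (by omega)
    have h₂ := ht (n + 1) hn
    rw [srStat]
    split_ifs
    · rfl
    · unfold srStep; positivity

lemma srStat_le {t : ℕ → ℝ} {c : ℝ} (hc : 0 ≤ c) (n : ℕ) : srStat t c n ≤ c := by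
  cases n with
  | zero => simpa [srStat] using hc
  | succ n =>
    rw [srStat]
    split_ifs with h
    · exact hc
    · exact (not_le.1 h).le

/-- Truncating the statistic at `c` turns the alarm count into a sum of bounded increments. -/
lemma srStat_add_srCount (t : ℕ → ℝ) (c : ℝ) (n : ℕ) :
    srStat t c n + c * srCount t c n =
      ∑ i ∈ Finset.range n, (min (srStep t i (srStat t c i)) c - srStat t c i) := by
  induction n with
  | zero => simp [srStat, srCount]
  | succ n ih =>
    rw [Finset.sum_range_succ, ← ih, srStat, srCount]
    split_ifs with h
    · rw [min_eq_right h]; push_cast; ring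
    · rw [min_eq_left (not_le.1 h).le]; ring

section Probability

variable {Ω : Type*} {m0 : MeasurableSpace Ω} {μ : Measure Ω} {G : ℕ → MeasurableSpace Ω}

lemma measurable_srStat {T : ℕ → Ω → ℝ} {N : ℕ} (hG : ∀ n < N, G n ≤ G (n + 1))
    (hT : ∀ n ≤ N, Measurable[G n] (T n)) (c : ℝ) :
    ∀ n ≤ N, Measurable[G n] fun ω => srStat (fun k => T k ω) c n := by
  intro n
  induction n with
  | zero => intro _; exact measurable_const
  | succ n ih =>
    intro hn
    have hp : Measurable[G (n + 1)]
        fun ω => srStep (fun k => T k ω) n (srStat (fun k => T k ω) c n) :=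
      ((hT (n + 1) hn).div ((hT n (by omega)).mono (hG n hn) le_rfl)).mul
        (((ih (by omega)).mono (hG n hn) le_rfl).add_const 1)
    exact Measurable.ite (measurableSet_le measurable_const hp) measurable_const hp

lemma measurable_srStep {T : ℕ → Ω → ℝ} {N : ℕ} (hG : ∀ n < N, G n ≤ G (n + 1))
    (hT : ∀ n ≤ N, Measurable[G n] (T n)) (c : ℝ) {n : ℕ} (hn : n < N) :
    Measurable[G (n + 1)]
      fun ω => srStep (fun k => T k ω) n (srStat (fun k => T k ω) c n) :=
  ((hT (n + 1) hn).div ((hT n hn.le).mono (hG n hn) le_rfl)).mul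
    (((measurable_srStat hG hT c n hn.le).mono (hG n hn) le_rfl).add_const 1)

/-- The truncated statistic grows by at most one in conditional mean. -/
lemma condExp_min_srStep_le [IsProbabilityMeasure μ] {T : ℕ → Ω → ℝ} {N : ℕ} {c : ℝ}
    (hc : 0 ≤ c) (hG : ∀ n < N, G n ≤ G (n + 1)) (hGm : ∀ n ≤ N, G n ≤ m0)
    (hT : ∀ n ≤ N, Measurable[G n] (T n)) (hint : ∀ n ≤ N, Integrable (T n) μ)
    (hpos : ∀ n ≤ N, ∀ ω, 0 < T n ω)
    (hmart : ∀ n < N, μ[T (n + 1) | G n] =ᵐ[μ] T n) {n : ℕ} (hn : n < N) :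
    ∀ᵐ ω ∂μ, (μ[fun ω => min (srStep (fun k => T k ω) n (srStat (fun k => T k ω) c n)) c | G n]) ω
      ≤ srStat (fun k => T k ω) c n + 1 := by
  set r : Ω → ℝ := fun ω => srStat (fun k => T k ω) c n with hr
  set f : Ω → ℝ := fun ω => min (srStep (fun k => T k ω) n (r ω)) c with hf
  have hrm : Measurable[G n] r := measurable_srStat hG hT c n hn.le
  have hr0 : ∀ ω, 0 ≤ r ω := fun ω => srStat_nonneg (fun k hk => hpos k hk ω) n hn.le
  have hrc : ∀ ω, r ω ≤ c := fun ω => srStat_le hc n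
  have hfm : Measurable[m0] f :=
    ((measurable_srStep hG hT c hn).min measurable_const).mono (hGm (n + 1) hn) le_rfl
  have hf0 : ∀ ω, 0 ≤ f ω := fun ω => le_min
    (mul_nonneg (div_pos (hpos (n + 1) hn ω) (hpos n hn.le ω)).le (by linarith [hr0 ω])) hc
  have hfc : ∀ ω, f ω ≤ c := fun ω => min_le_right _ _
  have hfb : ∀ᵐ ω ∂μ, ‖f ω‖ ≤ c := ae_of_all _ fun ω => by
    rw [Real.norm_of_nonneg (hf0 ω)]; exact hfc ω
  have hfi : Integrable f μ := .of_bound hfm.aestronglyMeasurable c hfb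
  have hTf : Integrable (T n * f) μ := (hint n hn.le).mul_bdd hfm.aestronglyMeasurable hfb
  have hrT : Integrable ((fun ω => r ω + 1) * T (n + 1)) μ := by
    refine (hint (n + 1) hn).bdd_mul (c := c + 1)
      ((hrm.mono (hGm n hn.le) le_rfl).add_const 1).aestronglyMeasurable (ae_of_all _ fun ω => ?_)
    rw [Real.norm_of_nonneg (by linarith [hr0 ω])]
    linarith [hrc ω]
  have hle : T n * f ≤ᵐ[μ] (fun ω => r ω + 1) * T (n + 1) := ae_of_all _ fun ω => by
    have h := hpos n hn.le ω
    calc T n ω * f ω ≤ T n ω * (T (n + 1) ω / T n ω * (r ω + 1)) :=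
          mul_le_mul_of_nonneg_left (min_le_left _ _) h.le
      _ = (r ω + 1) * T (n + 1) ω := by field_simp
  have h₁ := condExp_mono (m := G n) hTf hrT hle
  have h₂ := condExp_mul_of_stronglyMeasurable_left (hT n hn.le).stronglyMeasurable hTf hfi
  have h₃ := condExp_mul_of_stronglyMeasurable_left
    (hrm.add_const 1).stronglyMeasurable hrT (hint (n + 1) hn)
  filter_upwards [h₁, h₂, h₃, hmart n hn] with ω h₁ h₂ h₃ h₄
  rw [h₂, h₃, Pi.mul_apply, Pi.mul_apply, h₄, mul_comm] at h₁
  exact le_of_mul_le_mul_right h₁ (hpos n hn.le ω)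

/-- Orthogonality of bounded martingale differences. -/
lemma integral_sq_sum_sub_condExp_le [IsProbabilityMeasure μ] {N : ℕ} {f : ℕ → Ω → ℝ} {c : ℝ}
    (hG : ∀ n < N, G n ≤ G (n + 1)) (hGm : ∀ n ≤ N, G n ≤ m0)
    (hf : ∀ n < N, Measurable[G (n + 1)] (f n)) (hf0 : ∀ n < N, ∀ ω, 0 ≤ f n ω)
    (hfc : ∀ n < N, ∀ ω, f n ω ≤ c) :
    ∀ n ≤ N, StronglyMeasurable[G n] (∑ i ∈ Finset.range n, (f i - μ[f i | G i])) ∧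
      MemLp (∑ i ∈ Finset.range n, (f i - μ[f i | G i])) 2 μ ∧
      ∫ ω, ((∑ i ∈ Finset.range n, (f i - μ[f i | G i])) ω) ^ 2 ∂μ ≤ n * c ^ 2 := by
  intro n
  induction n with
  | zero => intro _; simpa using stronglyMeasurable_zero
  | succ n ih =>
    intro hn
    obtain ⟨hS, hS2, hSb⟩ := ih (by omega)
    rw [Finset.sum_range_succ]
    set S : Ω → ℝ := ∑ i ∈ Finset.range n, (f i - μ[f i | G i])
    set D : Ω → ℝ := f n - μ[f n | G n] with hD
    have hfm : Measurable[m0] (f n) := (hf n hn).mono (hGm (n + 1) hn) le_rfl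
    have hfi : Integrable (f n) μ := .of_bound hfm.aestronglyMeasurable c <|
      ae_of_all _ fun ω => by
        rw [Real.norm_of_nonneg (hf0 n hn ω)]; exact hfc n hn ω
    have hDm : StronglyMeasurable[G (n + 1)] D :=
      (hf n hn).stronglyMeasurable.sub (stronglyMeasurable_condExp.mono (hG n hn))
    have hc0 : 0 ≤ᵐ[μ] μ[f n | G n] := condExp_nonneg (ae_of_all _ (hf0 n hn))
    have hcc : μ[f n | G n] ≤ᵐ[μ] fun _ => c := by
      have := condExp_mono (m := G n) hfi (integrable_const c) (ae_of_all _ (hfc n hn))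
      rwa [condExp_const (hGm n (by omega))] at this
    have hDb : ∀ᵐ ω ∂μ, |D ω| ≤ c := by
      filter_upwards [hc0, hcc] with ω h₀ h₁
      have h₂ := hf0 n hn ω
      have h₃ := hfc n hn ω
      simp only [Pi.zero_apply] at h₀
      rw [hD, Pi.sub_apply, abs_le]
      constructor <;> linarith
    have hDa : AEStronglyMeasurable D μ := (hDm.mono (hGm (n + 1) hn)).aestronglyMeasurable
    have hD2 : MemLp D 2 μ := .of_bound hDa c hDb
    have hDi : Integrable D μ := hD2.integrable (by norm_num)
    have hSD : Integrable (S * D) μ := hS2.integrable_mul hD2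
    have hcond : μ[D | G n] =ᵐ[μ] 0 := by
      have h := condExp_sub hfi (integrable_condExp (μ := μ) (m := G n) (f := f n)) (G n)
      rw [condExp_of_stronglyMeasurable (hGm n (by omega)) stronglyMeasurable_condExp
        integrable_condExp, sub_self] at h
      exact h
    have horth : ∫ ω, (S * D) ω ∂μ = 0 := by
      rw [← integral_condExp (hGm n (by omega))]
      refine integral_eq_zero_of_ae ?_
      filter_upwards [condExp_mul_of_stronglyMeasurable_left hS hSD hDi, hcond] with ω h₁ h₂
      rw [h₁, Pi.mul_apply, h₂]
      simp
    refine ⟨(hS.mono (hG n hn)).add hDm, hS2.add hD2, ?_⟩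
    have hDs : ∫ ω, D ω ^ 2 ∂μ ≤ c ^ 2 := by
      have : ∫ ω, D ω ^ 2 ∂μ ≤ ∫ _, c ^ 2 ∂μ :=
        integral_mono_ae hD2.integrable_sq (integrable_const _) <| by
          filter_upwards [hDb] with ω h
          exact sq_le_sq' (abs_le.1 h).1 (abs_le.1 h).2
      simpa using this
    have hexp : ∀ ω, ((S + D) ω) ^ 2 = S ω ^ 2 + 2 * (S * D) ω + D ω ^ 2 := fun ω => by
      simp only [Pi.add_apply, Pi.mul_apply]; ring
    simp_rw [hexp]
    have hSSD : Integrable (fun ω => S ω ^ 2 + 2 * (S * D) ω) μ :=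
      hS2.integrable_sq.add (hSD.const_mul 2)
    rw [integral_add hSSD hD2.integrable_sq, integral_add hS2.integrable_sq (hSD.const_mul 2), integral_const_mul, horth]
    push_cast
    linarith

end Probability

/-- **Uniform validity of the Shiryaev–Roberts procedure for positive martingales.**
For every `c > 1` and `ε > 0` there exists `N₀` (depending only on `ε` and `c`) such that
for every `N ≥ N₀`, every probability space `(Ω, μ)`, every filtration `G_0 ⊆ … ⊆ G_N`
(of sub-σ-algebras), and every strictly positive martingale `(T_n, G_n)`, `n = 0, …, N`,
with `T_0 = 1`, the alarm count `A_N := max{ k : τ_k ≤ N }` of the Shiryaev–Roberts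
procedure with parameter `c` satisfies `P(A_N / N > 1/c + ε) ≤ ε`. -/
theorem shiryaevRoberts_uniform_validity (c : ℝ) (hc : 1 < c) (ε : ℝ) (hε : 0 < ε) :
    ∃ N₀ : ℕ, ∀ N, N₀ ≤ N →
      ∀ (Ω : Type) (m0 : MeasurableSpace Ω) (μ : Measure Ω), IsProbabilityMeasure μ →
      ∀ (G : ℕ → MeasurableSpace Ω) (T : ℕ → Ω → ℝ),
        (∀ n, n < N → G n ≤ G (n + 1)) →
        (∀ n, n ≤ N → G n ≤ m0) →
        (∀ n, n ≤ N → Measurable[G n] (T n)) →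
        (∀ n, n ≤ N → Integrable (T n) μ) →
        (∀ n, n ≤ N → ∀ ω, 0 < T n ω) →
        (∀ ω, T 0 ω = 1) →
        (∀ n, n < N → μ[T (n + 1) | G n] =ᵐ[μ] T n) →
        μ {ω | 1 / c + ε <
            ((sSup {k : ℕ | tauSRmart (fun n => T n ω) c k ≤ (N : ℕ∞)} : ℕ) : ℝ) / N} ≤
          ENNReal.ofReal ε := by
  obtain ⟨N₀, hN₀⟩ := exists_nat_ge (1 / ε ^ 3)
  refine ⟨N₀ + 1, fun N hN Ω m0 μ _ G T hG hGm hT hint hpos _ hmart => ?_⟩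
  have hN1 : (1 : ℝ) ≤ N := by exact_mod_cast (by omega : 1 ≤ N)
  have hNε : 1 / ε ^ 3 ≤ N := hN₀.trans (by exact_mod_cast (by omega : N₀ ≤ N))
  have hc0 : 0 < c := by linarith
  set f : ℕ → Ω → ℝ := fun n ω =>
    min (srStep (fun k => T k ω) n (srStat (fun k => T k ω) c n)) c with hf
  obtain ⟨-, hS2, hSb⟩ := integral_sq_sum_sub_condExp_le (μ := μ) (f := f) (c := c) hG hGm
    (fun n hn => (measurable_srStep hG hT c hn).min measurable_const)
    (fun n hn ω => le_min (mul_nonneg (div_pos (hpos (n + 1) hn ω) (hpos n hn.le ω)).le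
      (by linarith [srStat_nonneg (c := c) (fun k hk => hpos k hk ω) n hn.le])) hc0.le)
    (fun n _ ω => min_le_right _ _) N le_rfl
  set S : Ω → ℝ := ∑ i ∈ Finset.range N, (f i - μ[f i | G i]) with hS
  have hcond : ∀ᵐ ω ∂μ, ∀ n < N, (μ[f n | G n]) ω ≤ srStat (fun k => T k ω) c n + 1 :=
    ae_all_iff.2 fun n => by
      by_cases hn : n < N
      · filter_upwards [condExp_min_srStep_le hc0.le hG hGm hT hint hpos hmart hn] with ω h _
        exact h
      · exact ae_of_all _ fun ω h => absurd h hn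
  have hsub : {ω | 1 / c + ε <
      ((sSup {k : ℕ | tauSRmart (fun n => T n ω) c k ≤ (N : ℕ∞)} : ℕ) : ℝ) / N} ≤ᵐ[μ]
        {ω | (c * ε * N) ^ 2 ≤ S ω ^ 2} := by
    filter_upwards [hcond] with ω hω h
    change 1 / c + ε < _ at h
    change (c * ε * N) ^ 2 ≤ S ω ^ 2
    have hA : ((sSup {k : ℕ | tauSRmart (fun n => T n ω) c k ≤ (N : ℕ∞)} : ℕ) : ℝ) ≤
        srCount (fun n => T n ω) c N := by
      exact_mod_cast sSup_tauSRmart_le_srCount fun n hn => (hpos n hn ω).ne'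
    rw [lt_div_iff₀ (by linarith)] at h
    have h₁ := srStat_add_srCount (fun n => T n ω) c N
    have h₂ := srStat_nonneg (c := c) (fun k hk => hpos k hk ω) N le_rfl
    have h₃ : ∑ i ∈ Finset.range N, (f i ω - srStat (fun n => T n ω) c i) ≤
        ∑ i ∈ Finset.range N, ((f i ω - (μ[f i | G i]) ω) + 1) :=
      Finset.sum_le_sum fun i hi => by linarith [hω i (Finset.mem_range.1 hi)]
    rw [Finset.sum_add_distrib] at h₃
    have h₄ : S ω = ∑ i ∈ Finset.range N, (f i ω - (μ[f i | G i]) ω) := by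
      simp [hS, Finset.sum_apply]
    rw [← h₄] at h₃
    simp only [Finset.sum_const, Finset.card_range, nsmul_eq_mul, mul_one] at h₃
    have h₅ : c * ((1 / c + ε) * N) < c * srCount (fun n => T n ω) c N :=
      mul_lt_mul_of_pos_left (h.trans_le hA) hc0
    have h₆ : c * ((1 / c + ε) * N) = N + c * ε * N := by field_simp
    have h₇ : 0 ≤ c * ε * N := by positivity
    exact pow_le_pow_left₀ h₇ (by linarith) 2
  refine (measure_mono_ae hsub).trans ?_
  rw [← ENNReal.ofReal_toReal (measure_ne_top μ _)]
  refine ENNReal.ofReal_le_ofReal ?_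
  have hcheb := mul_meas_ge_le_integral_of_nonneg (ae_of_all _ fun ω => sq_nonneg (S ω))
    hS2.integrable_sq ((c * ε * N) ^ 2)
  have hb := hcheb.trans hSb
  change (c * ε * N) ^ 2 * (μ {ω | (c * ε * N) ^ 2 ≤ S ω ^ 2}).toReal ≤ N * c ^ 2 at hb
  have hk : (N : ℝ) * c ^ 2 ≤ (c * ε * N) ^ 2 * ε := by
    rw [div_le_iff₀ (by positivity)] at hNε
    have : 0 ≤ (N : ℝ) * c ^ 2 := by positivity
    nlinarith
  exact le_of_mul_le_mul_left (hb.trans hk) (by positivity)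
end
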